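/- Let n,m ≥ 1 and 1 ≤ i ≤ n. For all σ ∈ S_n and τ ∈ S_m one has P_i(B_i(σ,τ)) = (σ,τ) and P_i(T_i(σ,τ)) = (σ,τ). -/

import Mathlib

open Equiv

/-- The one-line value (0-indexed) of a permutation of `Fin N`, extended to all of `ℕ`
by the identity.  Position `j` (0-indexed) carries the value `pv σ j` (0-indexed). -/
def pv {N : ℕ} (σ : Equiv.Perm (Fin N)) (j : ℕ) : ℕ :=
  if h : j < N then (σ ⟨j, h⟩ : ℕ) else j

/-- The left weak (Bruhat) order on `S_N`: inclusion of inversion sets, where the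
inversion set of `σ` is `{(p,q) | p < q ∧ σ p > σ q}`. -/
def wle {N : ℕ} (σ τ : Equiv.Perm (Fin N)) : Prop :=
  ∀ p q : Fin N, p < q → σ q < σ p → τ q < τ p

instance {N : ℕ} (σ τ : Equiv.Perm (Fin N)) : Decidable (wle σ τ) :=
  inferInstanceAs (Decidable (∀ p q : Fin N, p < q → σ q < σ p → τ q < τ p))

/-- The `a`-values of the insertion construction `B_i` (0-indexed values):
`avv m s x = x` if `x < s` and `x + m - 1` otherwise. -/
def avv (m s x : ℕ) : ℕ := if x < s then x else x + m - 1

/-- The one-line values of the permutation `B_i(σ,τ) ∈ S_{n+m-1}`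
(0-indexed position `i`, with `i < n`, and 0-indexed values). -/
def BFun {n m : ℕ} (i : ℕ) (σ : Equiv.Perm (Fin n)) (τ : Equiv.Perm (Fin m)) (j : ℕ) : ℕ :=
  if j < i then avv m (pv σ i) (pv σ j)
  else if j < i + m then pv τ (j - i) + pv σ i
  else avv m (pv σ i) (pv σ (j - m + 1))

/-- `ρ ∈ S_{n+m-1}` is the permutation `B_i(σ,τ)`. -/
def IsB {n m : ℕ} (i : ℕ) (σ : Equiv.Perm (Fin n)) (τ : Equiv.Perm (Fin m))
    (ρ : Equiv.Perm (Fin (n + m - 1))) : Prop :=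
  ∀ j : ℕ, j < n + m - 1 → pv ρ j = BFun i σ τ j

/-- The set of entries of the first block `L₁` of `B_i(σ,τ)` (positions `< i`, 0-indexed). -/
def bL1 {n m : ℕ} (i : ℕ) (σ : Equiv.Perm (Fin n)) (τ : Equiv.Perm (Fin m)) : Set ℕ :=
  BFun i σ τ '' {p | p < i}

/-- The set of entries of the third block `L₃` of `B_i(σ,τ)`
(positions in `[i+m, n+m-2]`, 0-indexed). -/
def bL3 {n m : ℕ} (i : ℕ) (σ : Equiv.Perm (Fin n)) (τ : Equiv.Perm (Fin m)) : Set ℕ :=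
  BFun i σ τ '' {p | i + m ≤ p ∧ p < n + m - 1}

/-- The number `k_σ`: the largest `j ≤ i` such that the interval `[σ_i - j, σ_i]`
(of actual integers, whence also `j ≤ σ_i`) is contained in `{L₁} ∪ {σ_i}`. -/
noncomputable def kpar {n m : ℕ} (i : ℕ) (σ : Equiv.Perm (Fin n)) (τ : Equiv.Perm (Fin m)) : ℕ :=
  sSup {j | j ≤ i ∧ j ≤ pv σ i ∧
    Set.Icc (pv σ i - j) (pv σ i) ⊆ insert (pv σ i) (bL1 i σ τ)}

/-- The number `l_σ`: the largest `j ≤ n - 1 - i` such that `[η, η + j] ⊆ {η} ∪ {L₃}`,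
where `η = σ_i + m - 1`. -/
noncomputable def lpar {n m : ℕ} (i : ℕ) (σ : Equiv.Perm (Fin n)) (τ : Equiv.Perm (Fin m)) : ℕ :=
  sSup {j | j ≤ n - 1 - i ∧
    Set.Icc (pv σ i + m - 1) (pv σ i + m - 1 + j) ⊆ insert (pv σ i + m - 1) (bL3 i σ τ)}

/-- `A_{1,b}`: the entries of `L₁` smaller than `σ_i - k_σ`. -/
noncomputable def A1b {n m : ℕ} (i : ℕ) (σ : Equiv.Perm (Fin n)) (τ : Equiv.Perm (Fin m)) :
    Set ℕ := {x ∈ bL1 i σ τ | x < pv σ i - kpar i σ τ}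

/-- `A_{1,t}`: the entries of `L₁` bigger than `σ_i`. -/
def A1t {n m : ℕ} (i : ℕ) (σ : Equiv.Perm (Fin n)) (τ : Equiv.Perm (Fin m)) : Set ℕ :=
  {x ∈ bL1 i σ τ | pv σ i < x}

/-- `A_{3,b}`: the entries of `L₃` smaller than `η = σ_i + m - 1`. -/
def A3b {n m : ℕ} (i : ℕ) (σ : Equiv.Perm (Fin n)) (τ : Equiv.Perm (Fin m)) : Set ℕ :=
  {x ∈ bL3 i σ τ | x < pv σ i + m - 1}

/-- `A_{3,t}`: the entries of `L₃` bigger than `η + l_σ`. -/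
noncomputable def A3t {n m : ℕ} (i : ℕ) (σ : Equiv.Perm (Fin n)) (τ : Equiv.Perm (Fin m)) :
    Set ℕ := {x ∈ bL3 i σ τ | pv σ i + m - 1 + lpar i σ τ < x}

/-- `ρ ∈ S_{n+m-1}` is the permutation `T_i(σ,τ)`:  for `m = 1` it is `σ` itself;
for `m ≥ 2` its three blocks standardize like those of `B_i(σ,τ)` and have the
prescribed entry sets. -/
noncomputable def IsT {n m : ℕ} (i : ℕ) (σ : Equiv.Perm (Fin n)) (τ : Equiv.Perm (Fin m))
    (ρ : Equiv.Perm (Fin (n + m - 1))) : Prop :=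
  if m = 1 then (∀ p : ℕ, pv ρ p = pv σ p)
  else
    (∀ p q : ℕ, p < i → q < i → (pv ρ p < pv ρ q ↔ BFun i σ τ p < BFun i σ τ q)) ∧
    (∀ p q : ℕ, i ≤ p → p < i + m → i ≤ q → q < i + m →
      (pv ρ p < pv ρ q ↔ BFun i σ τ p < BFun i σ τ q)) ∧
    (∀ p q : ℕ, i + m ≤ p → p < n + m - 1 → i + m ≤ q → q < n + m - 1 →
      (pv ρ p < pv ρ q ↔ BFun i σ τ p < BFun i σ τ q)) ∧
    pv ρ '' {p | p < i} =
      A1b i σ τ ∪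
        Set.Ico (pv σ i + m - 1 + lpar i σ τ - kpar i σ τ) (pv σ i + m - 1 + lpar i σ τ) ∪
        A1t i σ τ ∧
    pv ρ '' {p | i ≤ p ∧ p < i + m} =
      insert (pv σ i - kpar i σ τ) (insert (pv σ i + m - 1 + lpar i σ τ)
        (Set.Ioo (pv σ i - kpar i σ τ + lpar i σ τ)
          (pv σ i + m - 1 + lpar i σ τ - kpar i σ τ))) ∧
    pv ρ '' {p | i + m ≤ p ∧ p < n + m - 1} =
      A3b i σ τ ∪ Set.Ioc (pv σ i - kpar i σ τ) (pv σ i - kpar i σ τ + lpar i σ τ) ∪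
        A3t i σ τ

/-- `u^ρ`: the minimum of the entries of the middle block `L₂(ρ)` (positions `[i, i+m-1]`). -/
noncomputable def uPar {N : ℕ} (i m : ℕ) (ρ : Equiv.Perm (Fin N)) : ℕ :=
  sInf (pv ρ '' {p | i ≤ p ∧ p < i + m})

/-- `v^ρ`: the maximum of the entries of the middle block `L₂(ρ)`. -/
noncomputable def vPar {N : ℕ} (i m : ℕ) (ρ : Equiv.Perm (Fin N)) : ℕ :=
  sSup (pv ρ '' {p | i ≤ p ∧ p < i + m})

/-- `C_{1,m}^ρ`: the entries of the first block of `ρ` lying strictly between `u^ρ` and `v^ρ`. -/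
noncomputable def Cmid1 {N : ℕ} (i m : ℕ) (ρ : Equiv.Perm (Fin N)) : Set ℕ :=
  {x ∈ pv ρ '' {p | p < i} | uPar i m ρ < x ∧ x < vPar i m ρ}

/-- `C_{3,m}^ρ`: the entries of the third block of `ρ` lying strictly between `u^ρ` and `v^ρ`. -/
noncomputable def Cmid3 {N : ℕ} (i m : ℕ) (ρ : Equiv.Perm (Fin N)) : Set ℕ :=
  {x ∈ pv ρ '' {p | i + m ≤ p ∧ p < N} | uPar i m ρ < x ∧ x < vPar i m ρ}

/-- The sequence `(Bρ(1),…,Bρ(i-1), w, Bρ(i+m),…,Bρ(n+m-1))` of length `n`,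
used to produce the first component of `P_i(ρ)` by standardization (here `w = u + n₁`). -/
def concatFun {N : ℕ} (i m w : ℕ) (β : Equiv.Perm (Fin N)) (r : ℕ) : ℕ :=
  if r < i then pv β r else if r = i then w else pv β (r + m - 1)

/-- `P_i(ρ) = (σ,τ)`: for `m = 1` this means `σ = ρ` and `τ = id`; for `m ≥ 2` it is
expressed via the intermediate permutation `Bρ` (denoted `β`), whose blocks standardize
like those of `ρ` and have the prescribed entry sets, `σ` being the standardization of
`(β(1),…,β(i-1), u+n₁, β(i+m),…,β(n+m-1))` and `τ` the standardization of `L₂(ρ)`. -/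
noncomputable def IsP {n m : ℕ} (i : ℕ) (ρ : Equiv.Perm (Fin (n + m - 1)))
    (σ : Equiv.Perm (Fin n)) (τ : Equiv.Perm (Fin m)) : Prop :=
  if m = 1 then (∀ p : ℕ, pv σ p = pv ρ p) ∧ τ = 1
  else
    ∃ β : Equiv.Perm (Fin (n + m - 1)),
      (∀ p q : ℕ, p < i → q < i → (pv β p < pv β q ↔ pv ρ p < pv ρ q)) ∧
      (∀ p q : ℕ, i ≤ p → p < i + m → i ≤ q → q < i + m →
        (pv β p < pv β q ↔ pv ρ p < pv ρ q)) ∧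
      (∀ p q : ℕ, i + m ≤ p → p < n + m - 1 → i + m ≤ q → q < n + m - 1 →
        (pv β p < pv β q ↔ pv ρ p < pv ρ q)) ∧
      pv β '' {p | p < i} =
        {x ∈ pv ρ '' {p | p < i} | x < uPar i m ρ} ∪
          Set.Ico (uPar i m ρ) (uPar i m ρ + (Cmid1 i m ρ).ncard) ∪
          {x ∈ pv ρ '' {p | p < i} | vPar i m ρ < x} ∧
      pv β '' {p | i ≤ p ∧ p < i + m} =
        Set.Icc (uPar i m ρ + (Cmid1 i m ρ).ncard) (vPar i m ρ - (Cmid3 i m ρ).ncard) ∧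
      pv β '' {p | i + m ≤ p ∧ p < n + m - 1} =
        {x ∈ pv ρ '' {p | i + m ≤ p ∧ p < n + m - 1} | x < uPar i m ρ} ∪
          Set.Ioc (vPar i m ρ - (Cmid3 i m ρ).ncard) (vPar i m ρ) ∪
          {x ∈ pv ρ '' {p | i + m ≤ p ∧ p < n + m - 1} | vPar i m ρ < x} ∧
      (∀ p q : Fin n, σ p < σ q ↔
        concatFun i m (uPar i m ρ + (Cmid1 i m ρ).ncard) β p <
          concatFun i m (uPar i m ρ + (Cmid1 i m ρ).ncard) β q) ∧
      (∀ p q : Fin m, τ p < τ q ↔ pv ρ (i + p) < pv ρ (i + q))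

theorem eqOn_of_image_eq_of_lt_iff_lt {α β : Type*} [LinearOrder β] [WellFoundedLT β]
    {f g : α → β} {S : Set α} (himg : f '' S = g '' S)
    (hlt : ∀ p ∈ S, ∀ q ∈ S, (f p < f q ↔ g p < g q)) : Set.EqOn f g S := by
  suffices H : ∀ v : β, ∀ p ∈ S, f p = v ∨ g p = v → f p = g p from
    fun p hp => H _ p hp (Or.inl rfl)
  intro v
  induction v using WellFoundedLT.induction with
  | ind v ih =>
    rintro p hp (h | h)
    · rcases lt_trichotomy (g p) v with h' | h' | h'
      · exact ih _ h' p hp (Or.inr rfl)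
      · rw [h, h']
      · obtain ⟨q, hq, hqv⟩ : v ∈ g '' S := himg ▸ ⟨p, hp, h⟩
        have hlt' : f q < v := h ▸ (hlt q hq p hp).2 (hqv ▸ h')
        exact absurd (ih _ hlt' q hq (Or.inl rfl)) (hqv ▸ hlt'.ne)
    · rcases lt_trichotomy (f p) v with h' | h' | h'
      · exact ih _ h' p hp (Or.inl rfl)
      · rw [h, h']
      · obtain ⟨q, hq, hqv⟩ : v ∈ f '' S := himg.symm ▸ ⟨p, hp, h⟩
        have hlt' : g q < v := h ▸ (hlt q hq p hp).1 (hqv ▸ h')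
        exact absurd (ih _ hlt' q hq (Or.inr rfl)) (hqv ▸ hlt'.ne')

theorem perm_eq_of_lt_iff_lt {N : ℕ} {σ τ : Equiv.Perm (Fin N)}
    (h : ∀ p q : Fin N, σ p < σ q ↔ τ p < τ q) : σ = τ := by
  ext1 p
  refine eqOn_of_image_eq_of_lt_iff_lt (S := Set.univ) ?_ (fun p _ q _ => h p q) (Set.mem_univ p)
  simp [Set.image_univ, σ.surjective.range_eq, τ.surjective.range_eq]

theorem pv_coe {N : ℕ} (σ : Equiv.Perm (Fin N)) (p : Fin N) : pv σ p = σ p := by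
  simp [pv]

theorem pv_lt {N : ℕ} (σ : Equiv.Perm (Fin N)) {j : ℕ} (hj : j < N) : pv σ j < N := by
  simp [pv, hj]

theorem pv_injective {N : ℕ} (σ : Equiv.Perm (Fin N)) : Function.Injective (pv σ) := by
  intro p q h
  unfold pv at h
  split_ifs at h with hp hq hq
  · simpa using σ.injective (Fin.ext h)
  · have := (σ ⟨p, hp⟩).isLt
    omega
  · have := (σ ⟨q, hq⟩).isLt
    omega
  · exact h

theorem exists_pv_eq {N : ℕ} (σ : Equiv.Perm (Fin N)) {x : ℕ} (hx : x < N) :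
    ∃ j < N, pv σ j = x :=
  ⟨σ.symm ⟨x, hx⟩, Fin.isLt _, by simp [pv_coe]⟩

theorem perm_eq_of_pv_eq {N : ℕ} {σ τ : Equiv.Perm (Fin N)} (h : ∀ p, pv σ p = pv τ p) :
    σ = τ := by
  ext p
  rw [← pv_coe, ← pv_coe, h]

section Insertion

variable {n m : ℕ} {i : ℕ} (σ : Equiv.Perm (Fin n)) (τ : Equiv.Perm (Fin m))

theorem BFun_of_lt {j : ℕ} (hj : j < i) : BFun i σ τ j = avv m (pv σ i) (pv σ j) := by
  simp [BFun, hj]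

theorem BFun_middle {j : ℕ} (hj : j < m) : BFun i σ τ (i + j) = pv τ j + pv σ i := by
  simp [BFun, hj]

theorem BFun_of_gt (hm : 1 ≤ m) {j : ℕ} (hj : i < j) :
    BFun i σ τ (j + m - 1) = avv m (pv σ i) (pv σ j) := by
  have h : j + m - 1 - m + 1 = j := by omega
  rw [BFun, if_neg (by omega), if_neg (by omega), h]

theorem mem_bL1 {x : ℕ} : x ∈ bL1 i σ τ ↔ ∃ p < i, avv m (pv σ i) (pv σ p) = x := by
  constructor
  · rintro ⟨p, hp, rfl⟩
    exact ⟨p, hp, (BFun_of_lt σ τ hp).symm⟩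
  · rintro ⟨p, hp, rfl⟩
    exact ⟨p, hp, BFun_of_lt σ τ hp⟩

theorem exists_of_mem_bL3 (hm : 1 ≤ m) {x : ℕ} (hx : x ∈ bL3 i σ τ) :
    ∃ p, i < p ∧ avv m (pv σ i) (pv σ p) = x := by
  obtain ⟨p, ⟨hp, _⟩, rfl⟩ := hx
  have h : p + 1 - m + m - 1 = p := by omega
  refine ⟨p + 1 - m, by omega, ?_⟩
  rw [← BFun_of_gt σ τ hm (by omega), h]

theorem lt_or_gt_of_avv {s x y : ℕ} (h : avv m s x = y) (hx : x ≠ s) (hm : 1 ≤ m) :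
    y < s ∨ s + m - 1 < y := by
  unfold avv at h
  split_ifs at h <;> omega

theorem lt_or_gt_of_mem_bL1 (hm : 1 ≤ m) {x : ℕ} (hx : x ∈ bL1 i σ τ) :
    x < pv σ i ∨ pv σ i + m - 1 < x := by
  obtain ⟨p, hp, h⟩ := (mem_bL1 σ τ).1 hx
  exact lt_or_gt_of_avv h ((pv_injective σ).ne hp.ne) hm

theorem lt_or_gt_of_mem_bL3 (hm : 1 ≤ m) {x : ℕ} (hx : x ∈ bL3 i σ τ) :
    x < pv σ i ∨ pv σ i + m - 1 < x := by
  obtain ⟨p, hp, h⟩ := exists_of_mem_bL3 σ τ hm hx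
  exact lt_or_gt_of_avv h ((pv_injective σ).ne hp.ne') hm

theorem notMem_bL3_of_mem_bL1 (hm : 1 ≤ m) {x : ℕ} (hx : x ∈ bL1 i σ τ) :
    x ∉ bL3 i σ τ := by
  intro hx'
  obtain ⟨p, hp, h⟩ := (mem_bL1 σ τ).1 hx
  obtain ⟨q, hq, h'⟩ := exists_of_mem_bL3 σ τ hm hx'
  have hpq : pv σ p = pv σ q := by
    unfold avv at h h'
    split_ifs at h h' <;> omega
  have := pv_injective σ hpq
  omega

theorem BFun_image_middle (hm : 1 ≤ m) :
    BFun i σ τ '' {p | i ≤ p ∧ p < i + m} = Set.Icc (pv σ i) (pv σ i + m - 1) := by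
  ext x
  constructor
  · rintro ⟨p, ⟨hp, hp'⟩, rfl⟩
    obtain ⟨j, rfl⟩ := Nat.exists_eq_add_of_le hp
    have hj : j < m := by omega
    have := pv_lt τ hj
    rw [BFun_middle σ τ hj]
    constructor <;> omega
  · rintro ⟨hx, hx'⟩
    obtain ⟨j, hj, h⟩ := exists_pv_eq τ (x := x - pv σ i) (by omega)
    refine ⟨i + j, ⟨by omega, by omega⟩, ?_⟩
    rw [BFun_middle σ τ hj, h]
    omega

theorem kpar_spec : kpar i σ τ ≤ pv σ i ∧
    Set.Icc (pv σ i - kpar i σ τ) (pv σ i) ⊆ insert (pv σ i) (bL1 i σ τ) :=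
  (Nat.sSup_mem (s := {j | j ≤ i ∧ j ≤ pv σ i ∧
    Set.Icc (pv σ i - j) (pv σ i) ⊆ insert (pv σ i) (bL1 i σ τ)})
    ⟨0, by simp⟩ ⟨i, fun _ h => h.1⟩).2

theorem lpar_spec : Set.Icc (pv σ i + m - 1) (pv σ i + m - 1 + lpar i σ τ) ⊆
    insert (pv σ i + m - 1) (bL3 i σ τ) :=
  (Nat.sSup_mem (s := {j | j ≤ n - 1 - i ∧
    Set.Icc (pv σ i + m - 1) (pv σ i + m - 1 + j) ⊆ insert (pv σ i + m - 1) (bL3 i σ τ)})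
    ⟨0, by simp⟩ ⟨n - 1 - i, fun _ h => h.1⟩).2

theorem eq_of_lt_iff_lt_concatFun (hm : 1 ≤ m) {σ' : Equiv.Perm (Fin n)}
    {β : Equiv.Perm (Fin (n + m - 1))} {w : ℕ} (hw : w = pv σ i)
    (h1 : Set.EqOn (pv β) (BFun i σ τ) {p | p < i})
    (h3 : Set.EqOn (pv β) (BFun i σ τ) {p | i + m ≤ p ∧ p < n + m - 1})
    (h : ∀ p q : Fin n, σ' p < σ' q ↔ concatFun i m w β p < concatFun i m w β q) :
    σ' = σ := by
  have hc : ∀ r < n, concatFun i m w β r =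
      if r = i then pv σ i else avv m (pv σ i) (pv σ r) := by
    intro r hr
    unfold concatFun
    rcases lt_trichotomy r i with hri | rfl | hri
    · rw [if_pos hri, if_neg hri.ne, h1 hri, BFun_of_lt σ τ hri]
    · simp [hw]
    · rw [if_neg hri.not_gt, if_neg hri.ne', if_neg hri.ne', h3 ⟨by omega, by omega⟩,
        BFun_of_gt σ τ hm hri]
  refine perm_eq_of_lt_iff_lt fun p q => ?_
  rw [h, hc p p.isLt, hc q q.isLt, Fin.lt_def, ← pv_coe, ← pv_coe]
  have hne : ∀ r : ℕ, r ≠ i → pv σ r ≠ pv σ i := fun r => (pv_injective σ).ne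
  have hp := hne p
  have hq := hne q
  unfold avv
  by_cases hpi : (p : ℕ) = i <;> by_cases hqi : (q : ℕ) = i <;>
    simp only [hpi, hqi, if_true, if_false] <;> split_ifs <;> grind

theorem eq_of_middle_lt_iff_lt {N : ℕ} {τ' : Equiv.Perm (Fin m)} {ρ : Equiv.Perm (Fin N)}
    (h2 : ∀ p q : ℕ, i ≤ p → p < i + m → i ≤ q → q < i + m →
      (pv ρ p < pv ρ q ↔ BFun i σ τ p < BFun i σ τ q))
    (h : ∀ p q : Fin m, τ' p < τ' q ↔ pv ρ (i + p) < pv ρ (i + q)) : τ' = τ := by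
  refine perm_eq_of_lt_iff_lt fun p q => ?_
  rw [h, h2 _ _ (by omega) (by omega) (by omega) (by omega), BFun_middle σ τ p.isLt,
    BFun_middle σ τ q.isLt, pv_coe, pv_coe, Fin.lt_def]
  omega

theorem IsP.eq_of_blocks (hm : 2 ≤ m) {ρ : Equiv.Perm (Fin (n + m - 1))}
    {σ' : Equiv.Perm (Fin n)} {τ' : Equiv.Perm (Fin m)} (hP : IsP i ρ σ' τ')
    (h1 : ∀ p q : ℕ, p < i → q < i → (pv ρ p < pv ρ q ↔ BFun i σ τ p < BFun i σ τ q))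
    (h2 : ∀ p q : ℕ, i ≤ p → p < i + m → i ≤ q → q < i + m →
      (pv ρ p < pv ρ q ↔ BFun i σ τ p < BFun i σ τ q))
    (h3 : ∀ p q : ℕ, i + m ≤ p → p < n + m - 1 → i + m ≤ q → q < n + m - 1 →
      (pv ρ p < pv ρ q ↔ BFun i σ τ p < BFun i σ τ q))
    (hw : uPar i m ρ + (Cmid1 i m ρ).ncard = pv σ i)
    (hL1 : {x ∈ pv ρ '' {p | p < i} | x < uPar i m ρ} ∪
          Set.Ico (uPar i m ρ) (uPar i m ρ + (Cmid1 i m ρ).ncard) ∪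
          {x ∈ pv ρ '' {p | p < i} | vPar i m ρ < x} = bL1 i σ τ)
    (hL3 : {x ∈ pv ρ '' {p | i + m ≤ p ∧ p < n + m - 1} | x < uPar i m ρ} ∪
          Set.Ioc (vPar i m ρ - (Cmid3 i m ρ).ncard) (vPar i m ρ) ∪
          {x ∈ pv ρ '' {p | i + m ≤ p ∧ p < n + m - 1} | vPar i m ρ < x} = bL3 i σ τ) :
    σ' = σ ∧ τ' = τ := by
  rw [IsP, if_neg (by omega)] at hP
  obtain ⟨β, hβ1, -, hβ3, hβL1, -, hβL3, hσ, hτ⟩ := hP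
  refine ⟨eq_of_lt_iff_lt_concatFun σ τ (by omega) hw ?_ ?_ hσ,
    eq_of_middle_lt_iff_lt σ τ h2 hτ⟩
  · exact eqOn_of_image_eq_of_lt_iff_lt (hβL1.trans hL1)
      fun p hp q hq => (hβ1 p q hp hq).trans (h1 p q hp hq)
  · exact eqOn_of_image_eq_of_lt_iff_lt (hβL3.trans hL3)
      fun p hp q hq => (hβ3 p q hp.1 hp.2 hq.1 hq.2).trans (h3 p q hp.1 hp.2 hq.1 hq.2)

theorem IsB.eq_of_isP (hm : 2 ≤ m) (hi : i < n) {ρ : Equiv.Perm (Fin (n + m - 1))}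
    {σ' : Equiv.Perm (Fin n)} {τ' : Equiv.Perm (Fin m)} (hB : IsB i σ τ ρ)
    (hP : IsP i ρ σ' τ') : σ' = σ ∧ τ' = τ := by
  have e1 : pv ρ '' {p | p < i} = bL1 i σ τ :=
    Set.image_congr fun p (hp : p < i) => hB p (by omega)
  have e2 : pv ρ '' {p | i ≤ p ∧ p < i + m} = Set.Icc (pv σ i) (pv σ i + m - 1) := by
    rw [← BFun_image_middle σ τ (by omega)]
    exact Set.image_congr fun p hp => hB p (by have := hp.2; omega)
  have e3 : pv ρ '' {p | i + m ≤ p ∧ p < n + m - 1} = bL3 i σ τ :=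
    Set.image_congr fun p hp => hB p hp.2
  have hle : pv σ i ≤ pv σ i + m - 1 := by omega
  have hu : uPar i m ρ = pv σ i := by rw [uPar, e2, csInf_Icc hle]
  have hv : vPar i m ρ = pv σ i + m - 1 := by rw [vPar, e2, csSup_Icc hle]
  have hL1 := fun x => lt_or_gt_of_mem_bL1 (i := i) σ τ (by omega) (x := x)
  have hL3 := fun x => lt_or_gt_of_mem_bL3 (i := i) σ τ (by omega) (x := x)
  have c1 : Cmid1 i m ρ = ∅ := by
    rw [Cmid1, e1, hu, hv, Set.eq_empty_iff_forall_notMem]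
    rintro x ⟨hx, h, h'⟩
    have := hL1 x hx
    omega
  have c3 : Cmid3 i m ρ = ∅ := by
    rw [Cmid3, e3, hu, hv, Set.eq_empty_iff_forall_notMem]
    rintro x ⟨hx, h, h'⟩
    have := hL3 x hx
    omega
  refine IsP.eq_of_blocks σ τ hm hP ?_ ?_ ?_ ?_ ?_ ?_
  · intro p q hp hq
    rw [hB p (by omega), hB q (by omega)]
  · intro p q _ hp _ hq
    rw [hB p (by omega), hB q (by omega)]
  · intro p q _ hp _ hq
    rw [hB p hp, hB q hq]
  · simp [c1, hu]
  · rw [e1, hu, hv, c1]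
    ext x
    have := hL1 x
    simp
    tauto
  · rw [e3, hu, hv, c3]
    ext x
    have := hL3 x
    simp
    tauto

theorem IsT.eq_of_isP (hm : 2 ≤ m) {ρ : Equiv.Perm (Fin (n + m - 1))}
    {σ' : Equiv.Perm (Fin n)} {τ' : Equiv.Perm (Fin m)} (hT : IsT i σ τ ρ)
    (hP : IsP i ρ σ' τ') : σ' = σ ∧ τ' = τ := by
  rw [IsT, if_neg (by omega)] at hT
  obtain ⟨h1, h2, h3, e1, e2, e3⟩ := hT
  obtain ⟨hk, hkL⟩ := kpar_spec (i := i) σ τ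
  have hlL := lpar_spec (i := i) σ τ
  have hL1 := fun x => lt_or_gt_of_mem_bL1 (i := i) σ τ (by omega) (x := x)
  have hL3 := fun x => lt_or_gt_of_mem_bL3 (i := i) σ τ (by omega) (x := x)
  have hdisj := fun x => notMem_bL3_of_mem_bL1 (i := i) σ τ (by omega) (x := x)
  unfold A1b A1t at e1
  unfold A3b A3t at e3
  generalize kpar i σ τ = k at *
  generalize lpar i σ τ = l at *
  generalize hs : pv σ i = s at *
  have hkL' : ∀ x, s - k ≤ x → x < s → x ∈ bL1 i σ τ := fun x hx hx' =>
    (hkL ⟨hx, hx'.le⟩).resolve_left (by omega)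
  have hlL' : ∀ x, s + m - 1 < x → x ≤ s + m - 1 + l → x ∈ bL3 i σ τ := fun x hx hx' =>
    (hlL ⟨hx.le, hx'⟩).resolve_left (by omega)
  have hu : uPar i m ρ = s - k := by
    rw [uPar, e2]
    refine IsLeast.csInf_eq ⟨by simp, ?_⟩
    rintro x (rfl | rfl | ⟨hx, hx'⟩) <;> omega
  have hv : vPar i m ρ = s + m - 1 + l := by
    rw [vPar, e2]
    refine IsGreatest.csSup_eq ⟨by simp, ?_⟩
    rintro x (rfl | rfl | ⟨hx, hx'⟩) <;> omega
  have hL1t : ∀ x ∈ bL1 i σ τ, s ≤ x → s + m - 1 + l < x := by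
    intro x hx hsx
    by_contra hlt
    exact hdisj x hx (hlL' x (by have := hL1 x hx; omega) (by omega))
  have hL3b : ∀ x ∈ bL3 i σ τ, x ≤ s + m - 1 → x < s - k := by
    intro x hx hsx
    by_contra hlt
    exact hdisj x (hkL' x (by omega) (by have := hL3 x hx; omega)) hx
  have c1 : Cmid1 i m ρ = Set.Ico (s + m - 1 + l - k) (s + m - 1 + l) := by
    rw [Cmid1, e1, hu, hv]
    ext x
    have := hL1t x
    simp only [Set.mem_ofPred_eq, Set.mem_union, Set.mem_Ico]
    grind
  have c3 : Cmid3 i m ρ = Set.Ioc (s - k) (s - k + l) := by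
    rw [Cmid3, e3, hu, hv]
    ext x
    have := hL3b x
    simp only [Set.mem_ofPred_eq, Set.mem_union, Set.mem_Ioc]
    grind
  have n1 : (Cmid1 i m ρ).ncard = k := by
    rw [c1, ← Finset.coe_Ico, Set.ncard_coe_finset, Nat.card_Ico]
    omega
  have n3 : (Cmid3 i m ρ).ncard = l := by
    rw [c3, ← Finset.coe_Ioc, Set.ncard_coe_finset, Nat.card_Ioc]
    omega
  refine IsP.eq_of_blocks σ τ hm hP h1 h2 h3 (by omega) ?_ ?_
  · rw [e1, hu, hv, n1]
    ext x
    have := hL1t x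
    have := hkL' x
    simp only [Set.mem_ofPred_eq, Set.mem_union, Set.mem_Ico]
    grind
  · rw [e3, hu, hv, n3]
    ext x
    have := hL3b x
    have := hlL' x
    simp only [Set.mem_ofPred_eq, Set.mem_union, Set.mem_Ioc]
    grind

end Insertion

theorem pv_eq_of_isB_one {n i : ℕ} (hi : i < n) {σ : Equiv.Perm (Fin n)}
    {τ : Equiv.Perm (Fin 1)} {ρ : Equiv.Perm (Fin (n + 1 - 1))} (hB : IsB i σ τ ρ) (p : ℕ) :
    pv ρ p = pv σ p := by
  by_cases hp : p < n
  · rw [hB p hp]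
    rcases lt_trichotomy p i with h | rfl | h
    · simp [BFun_of_lt σ τ h, avv]
    · have := pv_lt τ Nat.zero_lt_one
      have := BFun_middle (i := p) σ τ Nat.zero_lt_one
      simp only [add_zero] at this
      omega
    · simpa [avv] using BFun_of_gt σ τ le_rfl h
  · simp [pv, hp]

/-- **Theorem.** `P_i ∘ B_i = Id = P_i ∘ T_i`. -/
theorem P_comp_B_and_T {n m : ℕ} (hn : 1 ≤ n) (hm : 1 ≤ m) (i : ℕ) (hi : i < n)
    (σ : Equiv.Perm (Fin n)) (τ : Equiv.Perm (Fin m)) :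
    (∀ (ρ : Equiv.Perm (Fin (n + m - 1))) (σ' : Equiv.Perm (Fin n))
        (τ' : Equiv.Perm (Fin m)), IsB i σ τ ρ → IsP i ρ σ' τ' → σ' = σ ∧ τ' = τ) ∧
    (∀ (ρ : Equiv.Perm (Fin (n + m - 1))) (σ' : Equiv.Perm (Fin n))
        (τ' : Equiv.Perm (Fin m)), IsT i σ τ ρ → IsP i ρ σ' τ' → σ' = σ ∧ τ' = τ) := by
  rcases hm.eq_or_lt with rfl | hm2
  · have key : ∀ (ρ : Equiv.Perm (Fin (n + 1 - 1))) (σ' : Equiv.Perm (Fin n))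
        (τ' : Equiv.Perm (Fin 1)), (∀ p, pv ρ p = pv σ p) → IsP i ρ σ' τ' →
        σ' = σ ∧ τ' = τ := by
      intro ρ σ' τ' hρ hP
      rw [IsP, if_pos rfl] at hP
      exact ⟨perm_eq_of_pv_eq fun p => (hP.1 p).trans (hρ p), Subsingleton.elim _ _⟩
    refine ⟨fun ρ σ' τ' hB => key ρ σ' τ' (pv_eq_of_isB_one hi hB), fun ρ σ' τ' hT => ?_⟩
    rw [IsT, if_pos rfl] at hT
    exact key ρ σ' τ' hT
  · exact ⟨fun ρ σ' τ' hB hP => hB.eq_of_isP σ τ hm2 hi hP,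
      fun ρ σ' τ' hT hP => hT.eq_of_isP σ τ hm2 hP⟩
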